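/- Let w ∈ A₂ on ℝ with characteristic [w]_{A₂} = sup_I ⟨w⟩_I ⟨w^{-1}⟩_I. Define the modified dyadic square function S_π φ(x) = (Σ_{I∈D} |φ̂(I)|² |I|^{-1} 1_{πI}(x))^{1/2}, where πI is the dyadic parent of I. Then ‖S_π φ‖_{L²(w)} ≲ [w]_{A₂} ‖φ‖_{L²(w)} for all φ ∈ L²(w), with implied constant independent of w and φ. -/

import Mathlib

open MeasureTheory Set
open scoped ENNReal

noncomputable section

/-- The dyadic interval `[k·2^n, (k+1)·2^n)` encoded by the pair `p = (n, k)`. -/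
def dyad (p : ℤ × ℤ) : Set ℝ := Set.Ico ((p.2 : ℝ) * 2 ^ p.1) (((p.2 : ℝ) + 1) * 2 ^ p.1)

/-- Left half of a dyadic interval. -/
def dLeft (p : ℤ × ℤ) : ℤ × ℤ := (p.1 - 1, 2 * p.2)

/-- Right half of a dyadic interval. -/
def dRight (p : ℤ × ℤ) : ℤ × ℤ := (p.1 - 1, 2 * p.2 + 1)

/-- Dyadic parent. -/
def dParent (p : ℤ × ℤ) : ℤ × ℤ := (p.1 + 1, Int.fdiv p.2 2)

/-- Length of the dyadic interval. -/
def dLen (p : ℤ × ℤ) : ℝ := 2 ^ p.1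

/-- The L²-normalized Haar function `h_I = |I|^{-1/2}(1_{I₋} - 1_{I₊})`. -/
def haarF (p : ℤ × ℤ) : ℝ → ℝ := fun x =>
  (Real.sqrt (dLen p))⁻¹ *
    ((dyad (dLeft p)).indicator (fun _ => (1 : ℝ)) x -
      (dyad (dRight p)).indicator (fun _ => (1 : ℝ)) x)

/-- The averaging function `h_I^1 = |I|^{-1} 1_I`. -/
def haarAvg (p : ℤ × ℤ) : ℝ → ℝ := fun x =>
  (dLen p)⁻¹ * (dyad p).indicator (fun _ => (1 : ℝ)) x

/-- Haar coefficient `⟨f, h_I⟩`. -/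
def hc (f : ℝ → ℝ) (p : ℤ × ℤ) : ℝ := ∫ x, f x * haarF p x

/-- Average `⟨f⟩_I = |I|⁻¹ ∫_I f`. -/
def avg (f : ℝ → ℝ) (p : ℤ × ℤ) : ℝ := (dLen p)⁻¹ * ∫ x in dyad p, f x

open Classical in
/-- `δ(J, I) = 1` if `J ⊆ I₋` and `-1` otherwise (in particular if `J ⊆ I₊`). -/
def dsgn (q p : ℤ × ℤ) : ℝ := if dyad q ⊆ dyad (dLeft p) then 1 else -1

/-- `𝔰(J) = √2 · Σ_{K : K₋ ⊋ J} |K|⁻¹`. -/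
def sfrak (p : ℤ × ℤ) : ℝ :=
  Real.sqrt 2 * ∑' q : {q : ℤ × ℤ // dyad p ⊂ dyad (dLeft q)}, (dLen q.1)⁻¹

theorem log_sq_le (r : ℝ) (hr : 0 < r) : (Real.log r) ^ 2 ≤ r - 2 + r⁻¹ := by
  set ρ := Real.sqrt r with hρ
  have hρ0 : 0 < ρ := Real.sqrt_pos.2 hr
  have hρr : ρ ^ 2 = r := Real.sq_sqrt hr.le
  have h1 : Real.log r = 2 * Real.log ρ := by
    rw [← hρr, Real.log_pow]; push_cast; ring
  have h2 : (Real.log ρ) ^ 2 ≤ (Real.sinh (Real.log ρ)) ^ 2 := by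
    rw [sq_le_sq, Real.abs_sinh]
    exact Real.self_le_sinh_iff.2 (abs_nonneg _)
  rw [Real.sinh_log hρ0] at h2
  have h3 : ((ρ - ρ⁻¹) / 2) ^ 2 * 4 = r - 2 + r⁻¹ := by
    rw [← hρr]; field_simp; ring
  rw [h1]; nlinarith

theorem xlog_ge (x : ℝ) (h1 : -1 < x) (h2 : x < 1) :
    x ^ 2 / 2 ≤ (1 + x) * Real.log (1 + x) + (1 - x) * Real.log (1 - x) := by
  have key : ∀ t : ℝ, 0 < t → 2 * t - 2 * Real.sqrt t ≤ t * Real.log t := by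
    intro t ht
    have hs : 0 < Real.sqrt t := Real.sqrt_pos.2 ht
    have hst : Real.sqrt t ^ 2 = t := Real.sq_sqrt ht.le
    have h := Real.one_sub_inv_le_log_of_pos hs
    have h3 : Real.log t = 2 * Real.log (Real.sqrt t) := by
      rw [Real.log_sqrt ht.le]; ring
    have h4 : t * (1 - (Real.sqrt t)⁻¹) = t - Real.sqrt t := by
      nth_rewrite 1 [← hst]
      field_simp
      rw [mul_sub, ← sq, hst]; ring
    rw [h3]
    nlinarith [mul_le_mul_of_nonneg_left h ht.le]
  have a := key (1 + x) (by linarith)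
  have b := key (1 - x) (by linarith)
  set p := Real.sqrt (1 + x)
  set q := Real.sqrt (1 - x)
  have hp : p ^ 2 = 1 + x := Real.sq_sqrt (by linarith)
  have hq : q ^ 2 = 1 - x := Real.sq_sqrt (by linarith)
  have hp0 : 0 ≤ p := Real.sqrt_nonneg _
  have hq0 : 0 ≤ q := Real.sqrt_nonneg _
  have hpq : p * q ≤ 1 - x ^ 2 / 2 := by
    apply abs_le_of_sq_le_sq' _ (by nlinarith) |>.2
    rw [mul_pow, hp, hq]; nlinarith [sq_nonneg (x^2)]
  have hs : p + q ≤ 2 - x ^ 2 / 4 := by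
    apply abs_le_of_sq_le_sq' _ (by nlinarith) |>.2
    nlinarith [sq_nonneg (x^2)]
  linarith

/-- normalized log inequality -/
theorem xy_ge (x y : ℝ) (h1 : -1 < x) (h2 : x < 1) (h3 : -1 < y) (h4 : y < 1) :
    x ^ 2 / 4 - 5 * (y ^ 2 / (1 - y ^ 2)) ≤
      (1 + x) * (Real.log (1 + x) + Real.log (1 + y)) +
      (1 - x) * (Real.log (1 - x) + Real.log (1 - y)) := by
  have hy : 0 < 1 - y ^ 2 := by nlinarith
  have a := xlog_ge x h1 h2
  have hp : (0:ℝ) < 1 + y := by linarith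
  have hm : (0:ℝ) < 1 - y := by linarith
  have b : -(y ^ 2 / (1 - y ^ 2)) ≤ Real.log (1 + y) + Real.log (1 - y) := by
    rw [← Real.log_mul hp.ne' hm.ne']
    have h := Real.one_sub_inv_le_log_of_pos (mul_pos hp hm)
    have e : 1 - ((1 + y) * (1 - y))⁻¹ = -(y ^ 2 / (1 - y ^ 2)) := by
      rw [show (1 + y) * (1 - y) = 1 - y ^ 2 by ring]; field_simp; ring
    linarith
  have c : (Real.log (1 + y) - Real.log (1 - y)) ^ 2 ≤ 4 * (y ^ 2 / (1 - y ^ 2)) := by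
    rw [← Real.log_div hp.ne' hm.ne']
    have h := log_sq_le ((1 + y) / (1 - y)) (div_pos hp hm)
    have e : (1 + y) / (1 - y) - 2 + ((1 + y) / (1 - y))⁻¹ = 4 * (y ^ 2 / (1 - y ^ 2)) := by
      rw [show 1 - y ^ 2 = (1 + y) * (1 - y) by ring]; field_simp; ring
    linarith
  nlinarith [sq_nonneg (x / 2 + (Real.log (1 + y) - Real.log (1 - y)))]

/-- auxiliary Bellman function -/
def bellN (A u v : ℝ) : ℝ := 5 / 2 * (u - v⁻¹) - u * Real.log (u * v) / A

theorem bellN_nonneg (A u v : ℝ) (hu : 0 < u) (hv : 0 < v) (h1 : 1 ≤ u * v) (hA : u * v ≤ A) :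
    0 ≤ bellN A u v := by
  unfold bellN
  have hA0 : 0 < A := by linarith
  have hl := Real.log_le_sub_one_of_pos (mul_pos hu hv)
  have h2 : u * Real.log (u * v) / A ≤ u - v⁻¹ := by
    rw [div_le_iff₀ hA0]
    have h3 : 0 ≤ u - v⁻¹ := by
      rw [sub_nonneg, inv_le_iff_one_le_mul₀ hv]; exact h1
    have h4 : (u - v⁻¹) * (u * v) ≤ (u - v⁻¹) * A := mul_le_mul_of_nonneg_left hA h3
    have h5 : (u - v⁻¹) * (u * v) = u * (u * v - 1) := by field_simp
    have := mul_le_mul_of_nonneg_left hl hu.le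
    linarith
  have h3 : 0 ≤ u * Real.log (u * v) / A :=
    div_nonneg (mul_nonneg hu.le (Real.log_nonneg h1)) hA0.le
  linarith

theorem bellN_le (A u v : ℝ) (hu : 0 < u) (hv : 0 < v) (h1 : 1 ≤ u * v) (hA : u * v ≤ A) :
    bellN A u v ≤ 5 / 2 * u := by
  unfold bellN
  have hA0 : 0 < A := by linarith
  have h3 : 0 ≤ u * Real.log (u * v) / A :=
    div_nonneg (mul_nonneg hu.le (Real.log_nonneg h1)) hA0.le
  have := inv_pos.2 hv
  linarith

theorem bellN_mid (A u v x y : ℝ) (hu : 0 < u) (hv : 0 < v) (h1 : -1 < x) (h2 : x < 1)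
    (h3 : -1 < y) (h4 : y < 1) (hA0 : 0 < A) (hA : u * v ≤ A) :
    (bellN A (u * (1 + x)) (v * (1 + y)) + bellN A (u * (1 - x)) (v * (1 - y))) / 2
      + u * x ^ 2 / (8 * A) ≤ bellN A u v := by
  have hy : 0 < 1 - y ^ 2 := by nlinarith
  have k := xy_ge x y h1 h2 h3 h4
  have e1 : Real.log (u * (1 + x) * (v * (1 + y))) =
      Real.log (u * v) + (Real.log (1 + x) + Real.log (1 + y)) := by
    rw [← Real.log_mul (by linarith) (by linarith), ← Real.log_mul (by positivity)
      (mul_pos (by linarith) (by linarith)).ne']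
    congr 1; ring
  have e2 : Real.log (u * (1 - x) * (v * (1 - y))) =
      Real.log (u * v) + (Real.log (1 - x) + Real.log (1 - y)) := by
    rw [← Real.log_mul (by linarith) (by linarith), ← Real.log_mul (by positivity)
      (mul_pos (by linarith) (by linarith)).ne']
    congr 1; ring
  unfold bellN
  rw [e1, e2]
  set a := Real.log (1 + x) + Real.log (1 + y)
  set b := Real.log (1 - x) + Real.log (1 - y)
  set L := Real.log (u * v)
  set Z := y ^ 2 / (1 - y ^ 2) with hZ
  have hZ0 : 0 ≤ Z := div_nonneg (sq_nonneg _) hy.le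
  have e3 : ((v * (1 + y))⁻¹ + (v * (1 - y))⁻¹) / 2 = v⁻¹ * (1 + Z) := by
    have : 1 + y ≠ 0 := by linarith
    have : 1 - y ≠ 0 := by linarith
    have : (1 + y) * (1 - y) ≠ 0 := by positivity
    rw [hZ, show 1 - y ^ 2 = (1 + y) * (1 - y) by ring]; field_simp; ring
  have e4 : u / A ≤ v⁻¹ := by
    rw [div_le_iff₀ hA0, ← div_eq_inv_mul, le_div_iff₀ hv]; exact hA
  have e5 : u / A * Z ≤ v⁻¹ * Z := mul_le_mul_of_nonneg_right e4 hZ0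
  have e6 : u / A * (x ^ 2 / 4 - 5 * Z) ≤ u / A * ((1 + x) * a + (1 - x) * b) :=
    mul_le_mul_of_nonneg_left k (by positivity)
  have e7 : u * (1 + x) * (L + a) / A + u * (1 - x) * (L + b) / A
     = 2 * (u * L / A) + u / A * ((1 + x) * a + (1 - x) * b) := by field_simp; ring
  have e8 : u * x ^ 2 / (8 * A) = u / A * (x ^ 2 / 4) / 2 := by field_simp; ring
  rw [e8]
  linarith

/-- the full Bellman function -/
def bellB (A F m u v : ℝ) : ℝ := 2 * F - m ^ 2 / u - m ^ 2 / (u + bellN A u v)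

theorem bellB_le (A F m u v : ℝ) (hu : 0 < u) (hv : 0 < v) (h1 : 1 ≤ u * v) (hA : u * v ≤ A) :
    bellB A F m u v ≤ 2 * F := by
  have := bellN_nonneg A u v hu hv h1 hA
  unfold bellB
  have : 0 ≤ m ^ 2 / u := by positivity
  have : 0 ≤ m ^ 2 / (u + bellN A u v) := by positivity
  linarith

theorem bellB_nonneg (A F m u v : ℝ) (hu : 0 < u) (hv : 0 < v) (h1 : 1 ≤ u * v) (hA : u * v ≤ A)
    (hF : m ^ 2 / u ≤ F) : 0 ≤ bellB A F m u v := by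
  have := bellN_nonneg A u v hu hv h1 hA
  unfold bellB
  have : m ^ 2 / (u + bellN A u v) ≤ m ^ 2 / u :=
    div_le_div_of_nonneg_left (sq_nonneg _) hu (by linarith)
  linarith

theorem bellB_mid' (A F1 F2 u v x y m μ : ℝ) (hu : 0 < u) (hv : 0 < v) (h1 : -1 < x) (h2 : x < 1)
    (h3 : -1 < y) (h4 : y < 1) (hA : u * v ≤ A) (hA1 : 1 ≤ u * v)
    (ha : 1 ≤ u * (1 + x) * (v * (1 + y))) (ha' : u * (1 + x) * (v * (1 + y)) ≤ A)
    (hb : 1 ≤ u * (1 - x) * (v * (1 - y))) (hb' : u * (1 - x) * (v * (1 - y)) ≤ A) :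
    μ ^ 2 / u ≤ 200 * A * (bellB A ((F1 + F2) / 2) m u v -
      (bellB A F1 (m + μ) (u * (1 + x)) (v * (1 + y)) +
       bellB A F2 (m - μ) (u * (1 - x)) (v * (1 - y))) / 2) := by
  have hA0 : 0 < A := by linarith
  have hx1 : 0 < 1 + x := by linarith
  have hx2 : 0 < 1 - x := by linarith
  have hy1 : 0 < 1 + y := by linarith
  have hy2 : 0 < 1 - y := by linarith
  have hmid := bellN_mid A u v x y hu hv h1 h2 h3 h4 hA0 hA
  have n1 := bellN_nonneg A _ _ (mul_pos hu hx1) (mul_pos hv hy1) ha ha'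
  have n2 := bellN_nonneg A _ _ (mul_pos hu hx2) (mul_pos hv hy2) hb hb'
  have n0 := bellN_nonneg A u v hu hv hA1 hA
  have n3 := bellN_le A u v hu hv hA1 hA
  unfold bellB
  set N1 := bellN A (u * (1 + x)) (v * (1 + y))
  set N2 := bellN A (u * (1 - x)) (v * (1 - y))
  set N := bellN A u v
  set s1 := u * (1 + x) + N1 with hs1
  set s2 := u * (1 - x) + N2 with hs2
  have hs1p : 0 < s1 := by positivity
  have hs2p : 0 < s2 := by positivity
  have hsp : 0 < u + N := by positivity
  set δ := u * x ^ 2 / (8 * A) with hδ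
  have hδ0 : 0 ≤ δ := by positivity
  have hs : (s1 + s2) / 2 + δ ≤ u + N := by rw [hs1, hs2]; linarith
  -- convexity
  have c1 : m ^ 2 / ((s1 + s2) / 2) ≤ ((m + μ) ^ 2 / s1 + (m - μ) ^ 2 / s2) / 2 := by
    rw [div_add_div _ _ hs1p.ne' hs2p.ne', div_div, div_le_div_iff₀ (by positivity) (by positivity)]
    nlinarith [sq_nonneg ((m + μ) * s2 - (m - μ) * s1)]
  have c2 : m ^ 2 / (u + N) + m ^ 2 * x ^ 2 / (100 * A * u) ≤ m ^ 2 / ((s1 + s2) / 2) := by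
    set t := (s1 + s2) / 2 with ht
    have htp : 0 < t := by positivity
    have e : m ^ 2 / t - m ^ 2 / (u + N) = m ^ 2 * ((u + N - t) / (t * (u + N))) := by
      field_simp
    have e2 : x ^ 2 / (100 * A * u) ≤ (u + N - t) / (t * (u + N)) := by
      calc x ^ 2 / (100 * A * u) ≤ δ / (7 / 2 * u * (7 / 2 * u)) := by
            rw [hδ, div_div, div_le_div_iff₀ (by positivity) (by positivity)]
            have : 0 ≤ x ^ 2 * (A * u ^ 2) := by positivity
            nlinarith
        _ ≤ (u + N - t) / (t * (u + N)) := by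
            apply div_le_div₀ (by linarith) (by linarith) (by positivity)
            apply mul_le_mul (by linarith) (by linarith) (by positivity) (by positivity)
    have e3 := mul_le_mul_of_nonneg_left e2 (sq_nonneg m)
    rw [← e, ← mul_div_assoc] at e3
    linarith
  -- the unweighted term
  have c3 : ((m + μ) ^ 2 / (u * (1 + x)) + (m - μ) ^ 2 / (u * (1 - x))) / 2 - m ^ 2 / u =
      (μ - m * x) ^ 2 / (u * (1 - x ^ 2)) := by
    rw [show 1 - x ^ 2 = (1 + x) * (1 - x) by ring]
    field_simp; ring
  have c4 : (μ - m * x) ^ 2 / u ≤ (μ - m * x) ^ 2 / (u * (1 - x ^ 2)) := by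
    apply div_le_div_of_nonneg_left (sq_nonneg _) (mul_pos hu (by nlinarith))
    nlinarith [mul_nonneg hu.le (sq_nonneg x)]
  have c5 : (μ - m * x) ^ 2 / u + m ^ 2 * x ^ 2 / (100 * A * u) ≤
     2 * ((F1 + F2) / 2) - m ^ 2 / u - m ^ 2 / (u + N) -
      (2 * F1 - (m + μ) ^ 2 / (u * (1 + x)) - (m + μ) ^ 2 / s1 +
        (2 * F2 - (m - μ) ^ 2 / (u * (1 - x)) - (m - μ) ^ 2 / s2)) / 2 := by linarith
  refine le_trans ?_ (mul_le_mul_of_nonneg_left c5 (by positivity))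
  have e : 200 * A * ((μ - m * x) ^ 2 / u + m ^ 2 * x ^ 2 / (100 * A * u)) =
     (200 * A * (μ - m * x) ^ 2 + 2 * (m * x) ^ 2) / u := by field_simp; ring
  rw [e]
  apply div_le_div_of_nonneg_right _ hu.le
  have h5 : (μ - m * x) ^ 2 ≤ A * (μ - m * x) ^ 2 :=
    le_mul_of_one_le_left (sq_nonneg _) (by linarith)
  have h6 : μ ^ 2 ≤ 2 * (μ - m * x) ^ 2 + 2 * (m * x) ^ 2 := by
    linarith [sq_nonneg (μ - 2 * (m * x))]
  have h7 := sq_nonneg (μ - m * x)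
  linarith

theorem bellB_mid (A F1 F2 u1 u2 v1 v2 m1 m2 : ℝ) (hu1 : 0 < u1) (hu2 : 0 < u2)
    (hv1 : 0 < v1) (hv2 : 0 < v2)
    (hA : (u1 + u2) / 2 * ((v1 + v2) / 2) ≤ A) (hA1 : 1 ≤ (u1 + u2) / 2 * ((v1 + v2) / 2))
    (ha : 1 ≤ u1 * v1) (ha' : u1 * v1 ≤ A) (hb : 1 ≤ u2 * v2) (hb' : u2 * v2 ≤ A) :
    (m1 - m2) ^ 2 / (4 * ((u1 + u2) / 2)) ≤
      200 * A * (bellB A ((F1 + F2) / 2) ((m1 + m2) / 2) ((u1 + u2) / 2) ((v1 + v2) / 2) -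
      (bellB A F1 m1 u1 v1 + bellB A F2 m2 u2 v2) / 2) := by
  have hu : 0 < u1 + u2 := by linarith
  have hv : 0 < v1 + v2 := by linarith
  have e1 : u1 = (u1 + u2) / 2 * (1 + (u1 - u2) / (u1 + u2)) := by field_simp; ring
  have e2 : u2 = (u1 + u2) / 2 * (1 - (u1 - u2) / (u1 + u2)) := by field_simp; ring
  have e3 : v1 = (v1 + v2) / 2 * (1 + (v1 - v2) / (v1 + v2)) := by field_simp; ring
  have e4 : v2 = (v1 + v2) / 2 * (1 - (v1 - v2) / (v1 + v2)) := by field_simp; ring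
  have := bellB_mid' A F1 F2 ((u1 + u2) / 2) ((v1 + v2) / 2) ((u1 - u2) / (u1 + u2))
    ((v1 - v2) / (v1 + v2)) ((m1 + m2) / 2) ((m1 - m2) / 2) (by positivity) (by positivity)
    (by rw [lt_div_iff₀ hu]; linarith) (by rw [div_lt_iff₀ hu]; linarith)
    (by rw [lt_div_iff₀ hv]; linarith) (by rw [div_lt_iff₀ hv]; linarith) hA hA1
    (by rw [← e1, ← e3]; exact ha) (by rw [← e1, ← e3]; exact ha')
    (by rw [← e2, ← e4]; exact hb) (by rw [← e2, ← e4]; exact hb')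
  rw [← e1, ← e2, ← e3, ← e4, show (m1 + m2) / 2 + (m1 - m2) / 2 = m1 by ring,
    show (m1 + m2) / 2 - (m1 - m2) / 2 = m2 by ring] at this
  refine le_trans (le_of_eq ?_) this
  field_simp; ring

theorem dLen_pos (p : ℤ × ℤ) : 0 < dLen p := zpow_pos (by norm_num) _

theorem dLen_left (p : ℤ × ℤ) : dLen (dLeft p) = dLen p / 2 := by
  simp only [dLen, dLeft]
  rw [zpow_sub_one₀ (by norm_num)]; ring

theorem dLen_right (p : ℤ × ℤ) : dLen (dRight p) = dLen p / 2 := by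
  simp only [dLen, dRight]
  rw [zpow_sub_one₀ (by norm_num)]; ring

theorem dyad_meas (p : ℤ × ℤ) : MeasurableSet (dyad p) := measurableSet_Ico

theorem dyad_left_eq (p : ℤ × ℤ) :
    dyad (dLeft p) = Set.Ico ((p.2 : ℝ) * dLen p) (((p.2 : ℝ) + 1 / 2) * dLen p) := by
  have h := dLen_left p
  simp only [dLen, dLeft] at h
  simp only [dyad, dLeft, dLen]
  rw [h]; push_cast; congr 1 <;> ring

theorem dyad_right_eq (p : ℤ × ℤ) :
    dyad (dRight p) = Set.Ico (((p.2 : ℝ) + 1 / 2) * dLen p) (((p.2 : ℝ) + 1) * dLen p) := by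
  have h := dLen_left p
  simp only [dLen, dLeft] at h
  simp only [dyad, dRight, dLen]
  rw [h]; push_cast; congr 1 <;> ring

theorem dyad_union (p : ℤ × ℤ) : dyad (dLeft p) ∪ dyad (dRight p) = dyad p := by
  rw [dyad_left_eq, dyad_right_eq]
  have := dLen_pos p
  exact Set.Ico_union_Ico_eq_Ico (by nlinarith) (by nlinarith)

theorem dyad_disj (p : ℤ × ℤ) : Disjoint (dyad (dLeft p)) (dyad (dRight p)) := by
  rw [dyad_left_eq, dyad_right_eq]
  exact Set.Ico_disjoint_Ico_same

theorem integral_split (f : ℝ → ℝ) (p : ℤ × ℤ) (hf : IntegrableOn f (dyad p)) :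
    ∫ x in dyad p, f x = (∫ x in dyad (dLeft p), f x) + ∫ x in dyad (dRight p), f x := by
  rw [← dyad_union p] at hf ⊢
  exact setIntegral_union (dyad_disj p) (dyad_meas _) (hf.mono_set subset_union_left)
    (hf.mono_set subset_union_right)

theorem avg_split (f : ℝ → ℝ) (p : ℤ × ℤ) (hf : IntegrableOn f (dyad p)) :
    avg f p = (avg f (dLeft p) + avg f (dRight p)) / 2 := by
  have := (dLen_pos p).ne'
  unfold avg
  rw [integral_split f p hf, dLen_left, dLen_right]
  field_simp

theorem hc_eq (f : ℝ → ℝ) (p : ℤ × ℤ) (hf : IntegrableOn f (dyad p)) :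
    hc f p ^ 2 = dLen p * (avg f (dLeft p) - avg f (dRight p)) ^ 2 / 4 := by
  have h0 := dLen_pos p
  have hl : IntegrableOn f (dyad (dLeft p)) := hf.mono_set (by rw [← dyad_union p]; exact subset_union_left)
  have hr : IntegrableOn f (dyad (dRight p)) := hf.mono_set (by rw [← dyad_union p]; exact subset_union_right)
  have e : hc f p = (Real.sqrt (dLen p))⁻¹ *
      ((∫ x in dyad (dLeft p), f x) - ∫ x in dyad (dRight p), f x) := by
    unfold hc
    rw [← integral_indicator (dyad_meas _), ← integral_indicator (dyad_meas _),
      ← integral_sub (hl.integrable_indicator (dyad_meas _)) (hr.integrable_indicator (dyad_meas _)),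
      ← integral_const_mul]
    congr 1
    ext x
    unfold haarF
    simp only [Set.indicator]
    split_ifs <;> ring
  rw [e, mul_pow, inv_pow, Real.sq_sqrt h0.le]
  unfold avg
  rw [dLen_left, dLen_right]
  field_simp
  ring

theorem cs_avg (w φ : ℝ → ℝ) (hw : ∀ x, 0 < w x) (p : ℤ × ℤ)
    (hs : IntegrableOn (fun x => (w x)⁻¹) (dyad p))
    (hφ : IntegrableOn φ (dyad p)) (hF : IntegrableOn (fun x => φ x ^ 2 * w x) (dyad p))
    (hu : 0 < avg (fun x => (w x)⁻¹) p) :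
    avg φ p ^ 2 / avg (fun x => (w x)⁻¹) p ≤ avg (fun x => φ x ^ 2 * w x) p := by
  have h0 := inv_pos.2 (dLen_pos p)
  set t := avg φ p / avg (fun x => (w x)⁻¹) p with ht
  have h : ∫ x in dyad p, (2 * t) * φ x ≤ ∫ x in dyad p, (φ x ^ 2 * w x + t ^ 2 * (w x)⁻¹) := by
    apply integral_mono (hφ.const_mul _) (hF.add (hs.const_mul _))
    intro x
    have hx := hw x
    have : 0 ≤ w x * (φ x - t * (w x)⁻¹) ^ 2 := by positivity
    have e : w x * (φ x - t * (w x)⁻¹) ^ 2 = φ x ^ 2 * w x + t ^ 2 * (w x)⁻¹ - 2 * t * φ x := by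
      field_simp; ring
    simp only [Pi.add_apply]
    linarith
  rw [integral_const_mul, integral_add hF (hs.const_mul _), integral_const_mul] at h
  have h2 := mul_le_mul_of_nonneg_left h h0.le
  have h3 : 2 * t * avg φ p ≤ avg (fun x => φ x ^ 2 * w x) p + t ^ 2 * avg (fun x => (w x)⁻¹) p := by
    unfold avg; unfold avg at h2; linarith
  have e1 : t ^ 2 * avg (fun x => (w x)⁻¹) p = avg φ p ^ 2 / avg (fun x => (w x)⁻¹) p := by
    rw [ht]; field_simp
  have e2 : 2 * t * avg φ p = 2 * (avg φ p ^ 2 / avg (fun x => (w x)⁻¹) p) := by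
    rw [ht]; field_simp
  linarith

theorem locInt_dyad (f : ℝ → ℝ) (hf : LocallyIntegrable f volume) (p : ℤ × ℤ) :
    IntegrableOn f (dyad p) :=
  (hf.integrableOn_isCompact isCompact_Icc).mono_set Set.Ico_subset_Icc_self

theorem avg_pos (f : ℝ → ℝ) (hf : LocallyIntegrable f volume) (h : ∀ x, 0 < f x) (p : ℤ × ℤ) :
    0 < avg f p := by
  unfold avg
  apply mul_pos (inv_pos.2 (dLen_pos p))
  rw [setIntegral_pos_iff_support_of_nonneg_ae]
  · have : Function.support f = Set.univ := by
      ext x; simp [(h x).ne']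
    rw [this, Set.univ_inter]
    unfold dyad
    rw [Real.volume_Ico, ENNReal.ofReal_pos]
    have : (0 : ℝ) < 2 ^ p.1 := dLen_pos p
    linarith
  · exact Filter.Eventually.of_forall fun x => (h x).le
  · exact locInt_dyad f hf p

theorem one_le_avg (w : ℝ → ℝ) (hw : ∀ x, 0 < w x) (h1 : LocallyIntegrable w volume)
    (h2 : LocallyIntegrable (fun x => (w x)⁻¹) volume) (p : ℤ × ℤ) :
    1 ≤ avg (fun x => (w x)⁻¹) p * avg w p := by
  have hu := avg_pos _ h2 (fun x => inv_pos.2 (hw x)) p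
  have hfin : volume (dyad p) ≠ ⊤ := by unfold dyad; simp
  have := cs_avg w (fun _ => 1) hw p (locInt_dyad _ h2 p) (integrableOn_const hfin)
    (by simpa using locInt_dyad _ h1 p) hu
  have e : avg (fun _ => (1 : ℝ)) p = 1 := by
    unfold avg
    have := dLen_pos p
    have h3 : volume.real (dyad p) = dLen p := by
      unfold dyad dLen
      rw [Measure.real, Real.volume_Ico, ENNReal.toReal_ofReal]
      · ring
      · have : (0 : ℝ) < 2 ^ p.1 := dLen_pos p
        linarith
    simp [h3, this.ne']
  rw [e] at this
  simp only [one_pow, one_mul] at this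
  rw [div_le_iff₀ hu] at this
  change 1 ≤ avg (fun x => w x) p * _ at this
  rw [mul_comm]; exact this

theorem phi_intOn (w φ : ℝ → ℝ) (hw : ∀ x, 0 < w x)
    (h2 : LocallyIntegrable (fun x => (w x)⁻¹) volume) (hm : AEStronglyMeasurable φ volume)
    (hF : Integrable (fun x => φ x ^ 2 * w x) volume) (p : ℤ × ℤ) : IntegrableOn φ (dyad p) := by
  apply Integrable.mono' (hF.integrableOn.add (locInt_dyad _ h2 p)) hm.restrict
  refine Filter.Eventually.of_forall fun x => ?_
  have hx := hw x
  rw [Real.norm_eq_abs]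
  have : 0 ≤ w x * (|φ x| - (w x)⁻¹) ^ 2 := by positivity
  have e : w x * (|φ x| - (w x)⁻¹) ^ 2 = φ x ^ 2 * w x + (w x)⁻¹ - 2 * |φ x| := by
    rw [← sq_abs (φ x)]; field_simp; ring
  simp only [Pi.add_apply]
  linarith [abs_nonneg (φ x)]

def bellE (A : ℝ) (w φ : ℝ → ℝ) (p : ℤ × ℤ) : ℝ :=
  dLen p * bellB A (avg (fun x => φ x ^ 2 * w x) p) (avg φ p) (avg (fun x => (w x)⁻¹) p) (avg w p)

theorem bellE_nonneg (w φ : ℝ → ℝ) (A : ℝ) (hw : ∀ x, 0 < w x) (h1 : LocallyIntegrable w volume)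
    (h2 : LocallyIntegrable (fun x => (w x)⁻¹) volume)
    (hA : ∀ p : ℤ × ℤ, avg w p * avg (fun x => (w x)⁻¹) p ≤ A)
    (hm : AEStronglyMeasurable φ volume)
    (hF : Integrable (fun x => φ x ^ 2 * w x) volume) (p : ℤ × ℤ) : 0 ≤ bellE A w φ p := by
  have hu := avg_pos _ h2 (fun x => inv_pos.2 (hw x)) p
  have hv := avg_pos _ h1 hw p
  refine mul_nonneg (dLen_pos p).le (bellB_nonneg _ _ _ _ _ hu hv (one_le_avg w hw h1 h2 p)
    (by rw [mul_comm]; exact hA p) ?_)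
  exact cs_avg w φ hw p (locInt_dyad _ h2 p) (phi_intOn w φ hw h2 hm hF p) hF.integrableOn hu

theorem bellE_le (w φ : ℝ → ℝ) (A : ℝ) (hw : ∀ x, 0 < w x) (h1 : LocallyIntegrable w volume)
    (h2 : LocallyIntegrable (fun x => (w x)⁻¹) volume)
    (hA : ∀ p : ℤ × ℤ, avg w p * avg (fun x => (w x)⁻¹) p ≤ A) (p : ℤ × ℤ) :
    bellE A w φ p ≤ 2 * ∫ x in dyad p, φ x ^ 2 * w x := by
  have hu := avg_pos _ h2 (fun x => inv_pos.2 (hw x)) p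
  have hv := avg_pos _ h1 hw p
  have h := bellB_le A (avg (fun x => φ x ^ 2 * w x) p) (avg φ p) _ _ hu hv
    (one_le_avg w hw h1 h2 p) (by rw [mul_comm]; exact hA p)
  have h0 := dLen_pos p
  refine (mul_le_mul_of_nonneg_left h h0.le).trans (le_of_eq ?_)
  unfold avg; field_simp

theorem bellE_step (w φ : ℝ → ℝ) (A : ℝ) (hw : ∀ x, 0 < w x) (h1 : LocallyIntegrable w volume)
    (h2 : LocallyIntegrable (fun x => (w x)⁻¹) volume)
    (hA : ∀ p : ℤ × ℤ, avg w p * avg (fun x => (w x)⁻¹) p ≤ A)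
    (hm : AEStronglyMeasurable φ volume)
    (hF : Integrable (fun x => φ x ^ 2 * w x) volume) (p : ℤ × ℤ) :
    hc φ p ^ 2 / avg (fun x => (w x)⁻¹) p ≤
      200 * A * (bellE A w φ p - (bellE A w φ (dLeft p) + bellE A w φ (dRight p))) := by
  have hs := fun x => inv_pos.2 (hw x)
  have h0 := dLen_pos p
  have hφ := phi_intOn w φ hw h2 hm hF p
  have s1 := avg_split _ p (locInt_dyad _ h1 p)
  have s2 := avg_split _ p (locInt_dyad _ h2 p)
  have s3 := avg_split _ p hφ
  have s4 := avg_split (fun x => φ x ^ 2 * w x) p hF.integrableOn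
  have hA' : ∀ p : ℤ × ℤ, avg (fun x => (w x)⁻¹) p * avg w p ≤ A := fun p => by
    rw [mul_comm]; exact hA p
  have k := bellB_mid A (avg (fun x => φ x ^ 2 * w x) (dLeft p))
    (avg (fun x => φ x ^ 2 * w x) (dRight p))
    _ _ _ _ (avg φ (dLeft p)) (avg φ (dRight p))
    (avg_pos _ h2 hs (dLeft p)) (avg_pos _ h2 hs (dRight p))
    (avg_pos _ h1 hw (dLeft p)) (avg_pos _ h1 hw (dRight p))
    (by rw [← s1, ← s2]; exact hA' p) (by rw [← s1, ← s2]; exact one_le_avg w hw h1 h2 p)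
    (one_le_avg w hw h1 h2 _) (hA' _) (one_le_avg w hw h1 h2 _) (hA' _)
  rw [← s1, ← s2, ← s3, ← s4] at k
  rw [hc_eq φ p hφ]
  unfold bellE
  rw [dLen_left, dLen_right]
  have k2 := mul_le_mul_of_nonneg_left k h0.le
  have hu := avg_pos _ h2 hs p
  refine le_trans (le_of_eq ?_) (k2.trans (le_of_eq ?_))
  · field_simp
  · ring

theorem sum_double (g : ℤ → ℝ) (K : ℕ) :
    ∑ k ∈ Finset.Ico (-(2 * K : ℤ)) (2 * K), g k =
      ∑ k ∈ Finset.Ico (-(K : ℤ)) K, (g (2 * k) + g (2 * k + 1)) := by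
  induction K with
  | zero => simp
  | succ K ih =>
    have e : ∀ (h : ℤ → ℝ) (a b : ℤ), a ≤ b → ∑ k ∈ Finset.Ico (a - 1) (b + 1), h k =
        h (a - 1) + h b + ∑ k ∈ Finset.Ico a b, h k := by
      intro h a b hab
      have : Finset.Ico (a - 1) (b + 1) = insert (a - 1) (insert b (Finset.Ico a b)) := by
        ext k; simp only [Finset.mem_Ico, Finset.mem_insert]; omega
      rw [this, Finset.sum_insert, Finset.sum_insert]
      · ring
      · simp
      · simp only [Finset.mem_Ico, Finset.mem_insert]; omega
    push_cast
    rw [show (-(2 * ((K : ℤ) + 1))) = (-(2 * K) - 1) - 1 by ring,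
      show (2 * ((K : ℤ) + 1)) = (2 * K + 1) + 1 by ring, e _ _ _ (by omega), e _ _ _ (by omega), ih,
      show (-((K : ℤ) + 1)) = (-K) - 1 by ring, e _ _ _ (by omega)]
    rw [show 2 * (-(K : ℤ) - 1) + 1 = -(2 * K) - 1 by ring,
       show 2 * (-(K : ℤ) - 1) = -(2 * K) - 1 - 1 by ring]
    ring

theorem tree_sum (a E : ℤ × ℤ → ℝ) (hE : ∀ p, 0 ≤ E p) (ha : ∀ p, 0 ≤ a p)
    (h : ∀ p, a p ≤ E p - (E (dLeft p) + E (dRight p))) (F : Finset (ℤ × ℤ)) :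
    ∃ n0 : ℤ, ∑ p ∈ F, a p ≤ E (n0, -1) + E (n0, 0) := by
  obtain ⟨M, hM⟩ : ∃ M : ℕ, ∀ p ∈ F, p.1.natAbs ≤ M ∧ p.2.natAbs ≤ M := by
    refine ⟨F.sup (fun p => p.1.natAbs + p.2.natAbs), fun p hp => ?_⟩
    have := Finset.le_sup (f := fun p : ℤ × ℤ => p.1.natAbs + p.2.natAbs) hp
    omega
  set n0 : ℤ := 2 * M + 1 with hn0
  refine ⟨n0, ?_⟩
  have tel : ∀ N : ℕ, ∑ j ∈ Finset.range N, ∑ k ∈ Finset.Ico (-((2 ^ j : ℕ) : ℤ)) ((2 ^ j : ℕ) : ℤ),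
      a (n0 - j, k) ≤ E (n0, -1) + E (n0, 0) -
        ∑ k ∈ Finset.Ico (-((2 ^ N : ℕ) : ℤ)) ((2 ^ N : ℕ) : ℤ), E (n0 - N, k) := by
    intro N
    induction N with
    | zero =>
      have : Finset.Ico (-1 : ℤ) 1 = {-1, 0} := by rfl
      simp [this]
    | succ N ih =>
      rw [Finset.sum_range_succ]
      have e : ((2 ^ (N + 1) : ℕ) : ℤ) = 2 * ((2 ^ N : ℕ) : ℤ) := by push_cast; ring
      rw [e, sum_double]
      have : ∑ k ∈ Finset.Ico (-((2 ^ N : ℕ) : ℤ)) ((2 ^ N : ℕ) : ℤ), a (n0 - N, k) ≤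
        ∑ k ∈ Finset.Ico (-((2 ^ N : ℕ) : ℤ)) ((2 ^ N : ℕ) : ℤ), (E (n0 - N, k) -
          (E (n0 - (N + 1 : ℕ), 2 * k) + E (n0 - (N + 1 : ℕ), 2 * k + 1))) := by
        apply Finset.sum_le_sum
        intro k _
        have := h (n0 - N, k)
        simp only [dLeft, dRight] at this
        push_cast
        rw [← sub_sub n0]
        exact this
      rw [Finset.sum_sub_distrib] at this
      linarith
  set N := 3 * M + 2 with hN
  have hE0 : 0 ≤ ∑ k ∈ Finset.Ico (-((2 ^ N : ℕ) : ℤ)) ((2 ^ N : ℕ) : ℤ), E (n0 - N, k) :=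
    Finset.sum_nonneg fun _ _ => hE _
  refine le_trans ?_ ((tel N).trans (by linarith))
  rw [Finset.sum_sigma']
  have inj : ∀ p ∈ F, (⟨(n0 - p.1).toNat, p.2⟩ : (_ : ℕ) × ℤ) ∈ (Finset.range N).sigma
      (fun j => Finset.Ico (-((2 ^ j : ℕ) : ℤ)) ((2 ^ j : ℕ) : ℤ)) := by
    intro p hp
    obtain ⟨b1, b2⟩ := hM p hp
    rw [Finset.mem_sigma]
    have : M < (n0 - p.1).toNat := by omega
    have h3 : M < 2 ^ (n0 - p.1).toNat := this.trans Nat.lt_two_pow_self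
    simp only [Finset.mem_range, Finset.mem_Ico]
    omega
  calc ∑ p ∈ F, a p
      = ∑ p ∈ F, a (n0 - ((n0 - p.1).toNat : ℕ), p.2) := by
        apply Finset.sum_congr rfl
        intro p hp
        obtain ⟨b1, b2⟩ := hM p hp
        congr 1
        ext <;> simp only; omega
    _ = ∑ x ∈ F.image (fun p => (⟨(n0 - p.1).toNat, p.2⟩ : (_ : ℕ) × ℤ)), a (n0 - (x.1 : ℤ), x.2) := by
        rw [Finset.sum_image]
        intro p hp q hq hpq
        obtain ⟨b1, b2⟩ := hM p hp
        obtain ⟨b3, b4⟩ := hM q hq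
        simp only [Sigma.mk.injEq, heq_eq_eq] at hpq
        ext
        · omega
        · exact hpq.2
    _ ≤ _ := by
        apply Finset.sum_le_sum_of_subset_of_nonneg
        · intro x hx
          obtain ⟨p, hp, rfl⟩ := Finset.mem_image.1 hx
          exact inj p hp
        · intros; exact ha _

theorem dyad_parent (p : ℤ × ℤ) : p = dLeft (dParent p) ∨ p = dRight (dParent p) := by
  obtain ⟨n, k⟩ := p
  simp only [dLeft, dRight, dParent, Prod.mk.injEq]
  rw [Int.fdiv_eq_ediv_of_nonneg _ (by norm_num)]
  omega

theorem term_le (w : ℝ → ℝ) (A : ℝ) (hw : ∀ x, 0 < w x)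
    (h2 : LocallyIntegrable (fun x => (w x)⁻¹) volume)
    (hA : ∀ p : ℤ × ℤ, avg w p * avg (fun x => (w x)⁻¹) p ≤ A) (hA0 : 0 ≤ A) (p : ℤ × ℤ) :
    (dLen p)⁻¹ * ∫ x in dyad (dParent p), w x ≤ 4 * A / avg (fun x => (w x)⁻¹) p := by
  have hs := fun x => inv_pos.2 (hw x)
  have h0 := dLen_pos p
  have e : dLen (dParent p) = 2 * dLen p := by
    simp only [dLen, dParent]; rw [zpow_add_one₀ (by norm_num)]; ring
  have e1 : (dLen p)⁻¹ * ∫ x in dyad (dParent p), w x = 2 * avg w (dParent p) := by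
    unfold avg; rw [e]; field_simp
  have hu := avg_pos _ h2 hs p
  have hup := avg_pos _ h2 hs (dParent p)
  have h3 : avg (fun x => (w x)⁻¹) p ≤ 2 * avg (fun x => (w x)⁻¹) (dParent p) := by
    have s := avg_split _ _ (locInt_dyad _ h2 (dParent p))
    have a := avg_pos _ h2 hs (dLeft (dParent p))
    have b := avg_pos _ h2 hs (dRight (dParent p))
    rcases dyad_parent p with h | h <;> rw [← h] at s <;> linarith
  rw [e1, le_div_iff₀ hu]
  have h4 := hA (dParent p)
  by_cases hv : 0 ≤ avg w (dParent p)
  · nlinarith [mul_le_mul_of_nonneg_left h3 hv]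
  · nlinarith

theorem main_meas (w φ : ℝ → ℝ) (A : ℝ) (hw : ∀ x, 0 < w x) (h1 : LocallyIntegrable w volume)
    (h2 : LocallyIntegrable (fun x => (w x)⁻¹) volume)
    (hA : ∀ p : ℤ × ℤ, avg w p * avg (fun x => (w x)⁻¹) p ≤ A)
    (hm : AEStronglyMeasurable φ volume)
    (hF : Integrable (fun x => φ x ^ 2 * w x) volume) (F : Finset (ℤ × ℤ)) :
    ∑ p ∈ F, (hc φ p) ^ 2 * (dLen p)⁻¹ * ∫ x in dyad (dParent p), w x ≤
          1600 * A ^ 2 * ∫ x, (φ x) ^ 2 * w x := by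
  have hs := fun x => inv_pos.2 (hw x)
  have hA1 : 1 ≤ A := (one_le_avg w hw h1 h2 (0, 0)).trans (by rw [mul_comm]; exact hA _)
  have hA0 : 0 < A := by linarith
  obtain ⟨n0, hn⟩ := tree_sum (fun p => hc φ p ^ 2 / avg (fun x => (w x)⁻¹) p)
    (fun p => 200 * A * bellE A w φ p)
    (fun p => mul_nonneg (by positivity) (bellE_nonneg w φ A hw h1 h2 hA hm hF p))
    (fun p => div_nonneg (sq_nonneg _) (avg_pos _ h2 hs p).le)
    (fun p => by
      have := bellE_step w φ A hw h1 h2 hA hm hF p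
      linarith) F
  have hsum : bellE A w φ (n0, -1) + bellE A w φ (n0, 0) ≤ 2 * ∫ x, φ x ^ 2 * w x := by
    have b1 := bellE_le w φ A hw h1 h2 hA (n0, -1)
    have b2 := bellE_le w φ A hw h1 h2 hA (n0, 0)
    have hd : Disjoint (dyad (n0, -1)) (dyad (n0, 0)) := by
      unfold dyad
      simp only [Int.cast_neg, Int.cast_one, Int.cast_zero, neg_add_cancel, zero_mul]
      exact Set.Ico_disjoint_Ico_same
    have b3 := setIntegral_union hd (dyad_meas _) hF.integrableOn hF.integrableOn
    have b4 : ∫ x in dyad (n0, -1) ∪ dyad (n0, 0), φ x ^ 2 * w x ≤ ∫ x, φ x ^ 2 * w x :=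
      setIntegral_le_integral hF (Filter.Eventually.of_forall fun x =>
        mul_nonneg (sq_nonneg _) (hw x).le)
    linarith
  calc _ ≤ ∑ p ∈ F, 4 * A * (hc φ p ^ 2 / avg (fun x => (w x)⁻¹) p) := by
        apply Finset.sum_le_sum
        intro p _
        rw [mul_assoc]
        refine (mul_le_mul_of_nonneg_left (term_le w A hw h2 hA hA0.le p) (sq_nonneg _)).trans
          (le_of_eq ?_)
        ring
    _ = 4 * A * ∑ p ∈ F, (hc φ p ^ 2 / avg (fun x => (w x)⁻¹) p) := by rw [Finset.mul_sum]
    _ ≤ 4 * A * (200 * A * (2 * ∫ x, φ x ^ 2 * w x)) := by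
        apply mul_le_mul_of_nonneg_left _ (by positivity)
        refine hn.trans ?_
        rw [← mul_add]
        exact mul_le_mul_of_nonneg_left hsum (by positivity)
    _ = _ := by ring

theorem haarF_supp (p : ℤ × ℤ) (x : ℝ) (hx : x ∉ dyad p) : haarF p x = 0 := by
  rw [← dyad_union p] at hx
  have h1 : x ∉ dyad (dLeft p) := fun h => hx (Or.inl h)
  have h2 : x ∉ dyad (dRight p) := fun h => hx (Or.inr h)
  simp [haarF, h1, h2]

theorem haarF_sq (p : ℤ × ℤ) (x : ℝ) (hx : x ∈ dyad p) :
    haarF p x * haarF p x * dLen p = 1 := by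
  have h0 := dLen_pos p
  have hsq : (Real.sqrt (dLen p)) ^ 2 = dLen p := Real.sq_sqrt h0.le
  have hs : 0 < Real.sqrt (dLen p) := Real.sqrt_pos.2 h0
  have hd := Set.disjoint_left.1 (dyad_disj p)
  have e : (Real.sqrt (dLen p))⁻¹ * (Real.sqrt (dLen p))⁻¹ * dLen p = 1 := by
    nth_rewrite 3 [← hsq]; field_simp
  rw [← dyad_union p] at hx
  rcases hx with h | h
  · have h' := hd h
    simp only [haarF, Set.indicator_of_mem h, Set.indicator_of_notMem h']
    linarith
  · have h' : x ∉ dyad (dLeft p) := fun h'' => hd h'' h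
    simp only [haarF, Set.indicator_of_mem h, Set.indicator_of_notMem h']
    linarith

theorem haarF_meas (p : ℤ × ℤ) : Measurable (haarF p) := by
  unfold haarF
  exact ((measurable_const.indicator (dyad_meas _)).sub
    (measurable_const.indicator (dyad_meas _))).const_mul _

theorem hc_bad (φ : ℝ → ℝ) (p : ℤ × ℤ)
    (h : ¬ AEStronglyMeasurable φ (volume.restrict (dyad p))) : hc φ p = 0 := by
  unfold hc
  apply integral_undef
  intro hi
  apply h
  have h1 : AEStronglyMeasurable (fun x => φ x * haarF p x * (haarF p x * dLen p))
      (volume.restrict (dyad p)) :=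
    (hi.aestronglyMeasurable.mul
      ((haarF_meas p).mul_const _).aestronglyMeasurable).restrict
  refine h1.congr ?_
  refine (ae_restrict_iff' (dyad_meas p)).2 (Filter.Eventually.of_forall fun x hx => ?_)
  have := haarF_sq p x hx
  simp only
  calc φ x * haarF p x * (haarF p x * dLen p) = φ x * (haarF p x * haarF p x * dLen p) := by ring
    _ = φ x := by rw [this, mul_one]

open Classical in
theorem reduce_meas (w φ : ℝ → ℝ) (hw : ∀ x, 0 < w x)
    (hF : Integrable (fun x => φ x ^ 2 * w x) volume) (F : Finset (ℤ × ℤ)) :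
    ∃ ψ : ℝ → ℝ, AEStronglyMeasurable ψ volume ∧ Integrable (fun x => ψ x ^ 2 * w x) volume ∧
      ∫ x, ψ x ^ 2 * w x ≤ ∫ x, φ x ^ 2 * w x ∧ ∀ p ∈ F, hc φ p ^ 2 ≤ hc ψ p ^ 2 := by
  set G := F.filter (fun p => AEStronglyMeasurable φ (volume.restrict (dyad p))) with hG
  set S : Set ℝ := ⋃ p : G, dyad p.1 with hS
  have hSm : MeasurableSet S := MeasurableSet.iUnion fun p => dyad_meas _
  have e : (fun x => (S.indicator φ x) ^ 2 * w x) = S.indicator (fun x => φ x ^ 2 * w x) := by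
    ext x; by_cases hx : x ∈ S <;> simp [hx]
  refine ⟨S.indicator φ, ?_, ?_, ?_, ?_⟩
  · rw [aestronglyMeasurable_indicator_iff hSm, hS, aestronglyMeasurable_iUnion_iff]
    intro p
    exact (Finset.mem_filter.1 p.2).2
  · rw [e]; exact hF.indicator hSm
  · rw [e, integral_indicator hSm]
    exact setIntegral_le_integral hF (Filter.Eventually.of_forall fun x =>
        mul_nonneg (sq_nonneg _) (hw x).le)
  · intro p hp
    by_cases hg : AEStronglyMeasurable φ (volume.restrict (dyad p))
    · have hpG : p ∈ G := Finset.mem_filter.2 ⟨hp, hg⟩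
      have : hc (S.indicator φ) p = hc φ p := by
        unfold hc
        congr 1
        ext x
        by_cases hx : x ∈ dyad p
        · have : x ∈ S := Set.mem_iUnion.2 ⟨⟨p, hpG⟩, hx⟩
          rw [Set.indicator_of_mem this]
        · rw [haarF_supp p x hx]; simp
      rw [this]
    · rw [hc_bad φ p hg]; simp [sq_nonneg]

/-- Linear bound for the modified square function `S_π`:
`‖S_π φ‖²_{L²(w)} = Σ_I |φ̂(I)|² |I|⁻¹ ∫_{πI} w ≲ [w]²_{A₂} ‖φ‖²_{L²(w)}`. -/
theorem statement5 :
    ∃ C : ℝ, 0 < C ∧ ∀ (w : ℝ → ℝ), (∀ x, 0 < w x) →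
      LocallyIntegrable w volume → LocallyIntegrable (fun x => (w x)⁻¹) volume →
      ∀ A : ℝ, (∀ p : ℤ × ℤ, avg w p * avg (fun x => (w x)⁻¹) p ≤ A) →
      ∀ φ : ℝ → ℝ, Integrable (fun x => (φ x) ^ 2 * w x) volume →
      ∀ F : Finset (ℤ × ℤ),
        ∑ p ∈ F, (hc φ p) ^ 2 * (dLen p)⁻¹ * ∫ x in dyad (dParent p), w x ≤
          C * A ^ 2 * ∫ x, (φ x) ^ 2 * w x := by
  refine ⟨1600, by norm_num, ?_⟩
  intro w hw h1 h2 A hA φ hF F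
  obtain ⟨ψ, hm, hψ, hle, hcle⟩ := reduce_meas w φ hw hF F
  refine le_trans (Finset.sum_le_sum fun p hp => ?_)
    ((main_meas w ψ A hw h1 h2 hA hm hψ F).trans
      (mul_le_mul_of_nonneg_left hle (by positivity)))
  have hi : 0 ≤ ∫ x in dyad (dParent p), w x := integral_nonneg fun x => (hw x).le
  have h0 := (inv_pos.2 (dLen_pos p)).le
  exact mul_le_mul_of_nonneg_right (mul_le_mul_of_nonneg_right (hcle p hp) h0) hi
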